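/- arXiv:0908.1427 — 4 statements merged into one kernel-verified Lean document; each statement's English description precedes it below -/
import Mathlib

section
/- For all real numbers u > 0, s > 0 and every real number x, one has (2/Γ(s)) · ∫₀^∞ e^{-u y²} y^{2s-1} sin(x y²) dy = sin(s · arctan(x/u)) / (u² + x²)^{s/2}. -/
open MeasureTheory Real Set

lemma Complex.arg_eq_arctan_of_re_pos {z : ℂ} (hz : 0 < z.re) :
    z.arg = Real.arctan (z.im / z.re) := by
  have h := abs_lt.mp (Complex.abs_arg_lt_pi_div_two_iff.mpr (Or.inl hz))
  rw [← Complex.tan_arg, Real.arctan_tan h.1 h.2]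

lemma norm_rpow_mul_cexp_neg_mul_rpow (p q : ℝ) (z : ℂ) {t : ℝ} (ht : 0 < t) :
    ‖((t ^ q : ℝ) : ℂ) * Complex.exp (-z * (t ^ p : ℝ))‖ = t ^ q * Real.exp (-z.re * t ^ p) := by
  rw [norm_mul, Complex.norm_real, Complex.norm_exp, Complex.re_mul_ofReal, Complex.neg_re,
    Real.norm_of_nonneg (by positivity)]

lemma aestronglyMeasurable_rpow_mul_cexp_neg_mul_rpow (p q : ℝ) (z : ℂ) (μ : Measure ℝ) :
    AEStronglyMeasurable
      (fun t : ℝ ↦ ((t ^ q : ℝ) : ℂ) * Complex.exp (-z * (t ^ p : ℝ))) μ := by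
  have : Measurable fun t : ℝ ↦ ((t ^ q : ℝ) : ℂ) * Complex.exp (-z * (t ^ p : ℝ)) := by
    fun_prop
  exact this.aestronglyMeasurable

lemma integrableOn_rpow_mul_cexp_neg_mul_rpow {p q : ℝ} (hp : 0 < p) (hq : -1 < q) {z : ℂ}
    (hz : 0 < z.re) :
    IntegrableOn (fun t : ℝ ↦ ((t ^ q : ℝ) : ℂ) * Complex.exp (-z * (t ^ p : ℝ))) (Ioi 0) := by
  refine (integrableOn_rpow_mul_exp_neg_mul_rpow hq hp hz).mono'
    (aestronglyMeasurable_rpow_mul_cexp_neg_mul_rpow p q z _) ?_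
  filter_upwards [ae_restrict_mem measurableSet_Ioi] with t ht
  exact (norm_rpow_mul_cexp_neg_mul_rpow p q z ht).le

lemma differentiableAt_integral_rpow_mul_cexp_neg_mul_rpow {p q : ℝ} (hp : 0 < p) (hq : -1 < q)
    {z : ℂ} (hz : 0 < z.re) :
    DifferentiableAt ℂ
      (fun w : ℂ ↦ ∫ t in Ioi (0 : ℝ), ((t ^ q : ℝ) : ℂ) * Complex.exp (-w * (t ^ p : ℝ))) z := by
  have hnhds : {w : ℂ | z.re / 2 < w.re} ∈ nhds z :=
    (isOpen_lt continuous_const Complex.continuous_re).mem_nhds (half_lt_self hz)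
  refine (hasDerivAt_integral_of_dominated_loc_of_deriv_le
    (F' := fun w t ↦ -(((t ^ (q + p) : ℝ) : ℂ) * Complex.exp (-w * (t ^ p : ℝ))))
    (bound := fun t ↦ t ^ (q + p) * Real.exp (-(z.re / 2) * t ^ p)) hnhds
    (.of_forall fun w ↦ aestronglyMeasurable_rpow_mul_cexp_neg_mul_rpow p q w _)
    (integrableOn_rpow_mul_cexp_neg_mul_rpow hp hq hz)
    (aestronglyMeasurable_rpow_mul_cexp_neg_mul_rpow p (q + p) z _).neg ?_
    (integrableOn_rpow_mul_exp_neg_mul_rpow (by linarith) hp (half_pos hz))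
    ?_).2.differentiableAt
  · filter_upwards [ae_restrict_mem measurableSet_Ioi] with t ht w hw
    have ht' : 0 < t := ht
    rw [norm_neg, norm_rpow_mul_cexp_neg_mul_rpow p (q + p) w ht']
    have hw' : z.re / 2 < w.re := hw
    gcongr
  · filter_upwards [ae_restrict_mem measurableSet_Ioi] with t ht w _
    have h := ((((hasDerivAt_id w).neg).mul_const ((t ^ p : ℝ) : ℂ)).cexp).const_mul
      ((t ^ q : ℝ) : ℂ)
    refine h.congr_deriv ?_
    rw [Real.rpow_add ht]
    push_cast
    simp only [id, Pi.neg_apply]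
    ring

/-- The Gamma integral `∫ t ^ q * exp (-z * t ^ p)` over `(0, ∞)`, for complex `z` with positive
real part. -/
lemma integral_rpow_mul_cexp_neg_mul_rpow {p q : ℝ} (hp : 0 < p) (hq : -1 < q) {z : ℂ}
    (hz : 0 < z.re) :
    ∫ t in Ioi (0 : ℝ), ((t ^ q : ℝ) : ℂ) * Complex.exp (-z * (t ^ p : ℝ)) =
      z ^ ((-(q + 1) / p : ℝ) : ℂ) * ((1 / p * Real.Gamma ((q + 1) / p) : ℝ) : ℂ) := by
  have hopen : IsOpen {w : ℂ | 0 < w.re} := isOpen_lt continuous_const Complex.continuous_re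
  have hconn : IsPreconnected {w : ℂ | 0 < w.re} := (convex_halfSpace_re_gt 0).isPreconnected
  have hleft := DifferentiableOn.analyticOnNhd (fun w (hw : w ∈ {w : ℂ | 0 < w.re}) ↦
    (differentiableAt_integral_rpow_mul_cexp_neg_mul_rpow hp hq hw).differentiableWithinAt) hopen
  have hright : AnalyticOnNhd ℂ (fun w : ℂ ↦ w ^ ((-(q + 1) / p : ℝ) : ℂ) *
      ((1 / p * Real.Gamma ((q + 1) / p) : ℝ) : ℂ)) {w : ℂ | 0 < w.re} :=
    DifferentiableOn.analyticOnNhd (fun w hw ↦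
      ((differentiableAt_id.cpow_const (Or.inl hw)).mul_const _).differentiableWithinAt) hopen
  have hreal : ∀ r : ℝ, 0 < r →
      ∫ t in Ioi (0 : ℝ), ((t ^ q : ℝ) : ℂ) * Complex.exp (-(r : ℂ) * (t ^ p : ℝ)) =
        (r : ℂ) ^ ((-(q + 1) / p : ℝ) : ℂ) *
          ((1 / p * Real.Gamma ((q + 1) / p) : ℝ) : ℂ) := by
    intro r hr
    rw [← Complex.ofReal_cpow hr.le, ← Complex.ofReal_mul, ← mul_assoc,
      ← integral_rpow_mul_exp_neg_mul_rpow hp hq hr, ← integral_complex_ofReal]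
    push_cast
    rfl
  have hfreq : ∃ᶠ r : ℝ in nhdsWithin 1 {1}ᶜ, 0 < r :=
    (eventually_nhdsWithin_of_eventually_nhds (eventually_gt_nhds one_pos)).frequently
  have hmap : Filter.Tendsto ((↑) : ℝ → ℂ) (nhdsWithin 1 {1}ᶜ) (nhdsWithin 1 {1}ᶜ) := by
    refine tendsto_nhdsWithin_of_tendsto_nhds_of_eventually_within _ ?_ ?_
    · exact (Complex.continuous_ofReal.tendsto' 1 1 Complex.ofReal_one).mono_left nhdsWithin_le_nhds
    · filter_upwards [self_mem_nhdsWithin] with r hr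
      simpa using hr
  exact hleft.eqOn_of_preconnected_of_frequently_eq hright hconn (z₀ := 1) (by simp)
    (hmap.frequently (hfreq.mono hreal)) hz

theorem chen_integral_formula (u s x : ℝ) (hu : 0 < u) (hs : 0 < s) :
    (2 / Real.Gamma s) *
      ∫ y in Ioi (0 : ℝ), Real.exp (-u * y ^ 2) * y ^ (2 * s - 1) * Real.sin (x * y ^ 2) =
      Real.sin (s * Real.arctan (x / u)) / (u ^ 2 + x ^ 2) ^ (s / 2) := by
  obtain ⟨z, hre, him⟩ : ∃ z : ℂ, z.re = u ∧ z.im = -x := ⟨⟨u, -x⟩, rfl, rfl⟩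
  have hz : 0 < z.re := hre ▸ hu
  have hz0 : z ≠ 0 := by
    rintro rfl
    simp at hz
  have hq : -1 < 2 * s - 1 := by linarith
  have hnorm : ‖z‖ ^ s = (u ^ 2 + x ^ 2) ^ (s / 2) := by
    rw [Complex.norm_eq_sqrt_sq_add_sq, hre, him, neg_sq, Real.sqrt_eq_rpow,
      ← Real.rpow_mul (by positivity), one_div_mul_eq_div]
  have harg : z.arg = -Real.arctan (x / u) := by
    rw [Complex.arg_eq_arctan_of_re_pos hz, hre, him, neg_div, Real.arctan_neg]
  have hpow : (z ^ ((-s : ℝ) : ℂ)).im =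
      Real.sin (s * Real.arctan (x / u)) / (u ^ 2 + x ^ 2) ^ (s / 2) := by
    rw [Complex.cpow_ofReal_im, harg, Real.rpow_neg (norm_nonneg z), hnorm]
    rw [show -Real.arctan (x / u) * -s = s * Real.arctan (x / u) by ring]
    ring
  have hint : ∫ y in Ioi (0 : ℝ), Real.exp (-u * y ^ 2) * y ^ (2 * s - 1) * Real.sin (x * y ^ 2) =
      (∫ y in Ioi (0 : ℝ), ((y ^ (2 * s - 1) : ℝ) : ℂ) *
        Complex.exp (-z * (y ^ (2 : ℝ) : ℝ))).im := by
    rw [← RCLike.im_eq_complex_im,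
      ← integral_im (integrableOn_rpow_mul_cexp_neg_mul_rpow two_pos hq hz)]
    refine integral_congr_ae (.of_forall fun y ↦ ?_)
    simp only [RCLike.im_eq_complex_im, Complex.im_ofReal_mul, Complex.exp_im,
      Complex.re_mul_ofReal, Complex.im_mul_ofReal, Complex.neg_re, Complex.neg_im, hre, him,
      neg_neg, Real.rpow_two]
    ring
  have hΓ : Real.Gamma s ≠ 0 := (Real.Gamma_pos_of_pos hs).ne'
  rw [hint, integral_rpow_mul_cexp_neg_mul_rpow two_pos hq hz, Complex.im_mul_ofReal,
    show -(2 * s - 1 + 1) / 2 = -s by ring, show (2 * s - 1 + 1) / 2 = s by ring, hpow]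
  field_simp
end

section
/- For every real number t > 0, one has 2 · ∫₀^∞ sin(x t)/(e^{2πx} − 1) dx = 1/(e^t − 1) − 1/t + 1/2. -/
open MeasureTheory Real Set

lemma integrableOn_sin_mul_exp_neg_mul {a : ℝ} (ha : 0 < a) (t : ℝ) :
    IntegrableOn (fun x : ℝ => Real.sin (x * t) * Real.exp (-(a * x))) (Ioi 0) := by
  have h : IntegrableOn (fun x : ℝ => Real.exp (-a * x)) (Ioi 0) :=
    integrableOn_exp_mul_Ioi (by linarith) 0
  refine h.mono' (by fun_prop) (.of_forall fun x => ?_)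
  rw [norm_mul, Real.norm_eq_abs, Real.norm_eq_abs, Real.abs_exp, neg_mul]
  exact mul_le_of_le_one_left (Real.exp_pos _).le (Real.abs_sin_le_one _)

/-- The Laplace transform of the sine. -/
lemma integral_sin_mul_exp_neg_mul {a : ℝ} (ha : 0 < a) (t : ℝ) :
    ∫ x in Ioi (0 : ℝ), Real.sin (x * t) * Real.exp (-(a * x)) = t / (t ^ 2 + a ^ 2) := by
  have hre : (-a + t * Complex.I : ℂ).re < 0 := by simpa using ha
  have h := integral_exp_mul_complex_Ioi hre 0
  have him := integral_im (𝕜 := ℂ) (integrableOn_exp_mul_complex_Ioi hre 0)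
  rw [h] at him
  calc ∫ x in Ioi (0 : ℝ), Real.sin (x * t) * Real.exp (-(a * x))
      = ∫ x in Ioi (0 : ℝ), RCLike.im (Complex.exp ((-a + t * Complex.I) * x)) := by
        congr 1 with x
        simp [Complex.exp_im, mul_comm]
    _ = _ := by
        rw [him]
        simp [Complex.div_im, Complex.normSq_apply]
        ring

lemma integral_norm_sin_mul_exp_neg_mul_le {a t : ℝ} (ha : 0 < a) (ht : 0 ≤ t) :
    ∫ x in Ioi (0 : ℝ), ‖Real.sin (x * t) * Real.exp (-(a * x))‖ ≤ t * (1 / a ^ 2) := by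
  have key := integral_rpow_mul_exp_neg_mul_Ioi (a := 2) two_pos ha
  have hint : IntegrableOn (fun x : ℝ => x ^ ((2 : ℝ) - 1) * Real.exp (-(a * x))) (Ioi 0) :=
    .of_integral_ne_zero (by rw [key]; positivity)
  calc ∫ x in Ioi (0 : ℝ), ‖Real.sin (x * t) * Real.exp (-(a * x))‖
      ≤ ∫ x in Ioi (0 : ℝ), t * (x ^ ((2 : ℝ) - 1) * Real.exp (-(a * x))) := by
        refine setIntegral_mono_on (integrableOn_sin_mul_exp_neg_mul ha t).norm
          (hint.const_mul t) measurableSet_Ioi fun x hx => ?_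
        have hx : 0 < x := hx
        have h1 : (2 : ℝ) - 1 = 1 := by norm_num
        rw [norm_mul, Real.norm_eq_abs, Real.norm_eq_abs, Real.abs_exp, h1, Real.rpow_one,
          ← mul_assoc]
        gcongr
        calc |Real.sin (x * t)| ≤ |x * t| := Real.abs_sin_le_abs
          _ = t * x := by rw [abs_of_nonneg (by positivity), mul_comm]
    _ = t * (1 / a ^ 2) := by
        rw [integral_const_mul, key, Real.Gamma_two]
        simp

lemma tsum_exp_neg_succ_mul {y : ℝ} (hy : 0 < y) :
    ∑' n : ℕ, Real.exp (-((n + 1) * y)) = 1 / (Real.exp y - 1) := by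
  have h : ∀ n : ℕ, Real.exp (-((n + 1) * y)) = Real.exp (-y) * Real.exp (-y) ^ n := fun n => by
    rw [← Real.exp_nat_mul, ← Real.exp_add]
    ring_nf
  have h1 : 1 < Real.exp y := Real.one_lt_exp_iff.2 hy
  simp_rw [h]
  rw [tsum_mul_left, tsum_geometric_of_lt_one (Real.exp_pos _).le (by simpa using hy),
    Real.exp_neg]
  have : Real.exp y - 1 ≠ 0 := by linarith
  field_simp

/-- The partial fraction expansion of `coth (t / 2) / 2`. -/
lemma two_mul_tsum_div_sq_add_sq {t : ℝ} (ht : 0 < t) :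
    2 * ∑' n : ℕ, t / (t ^ 2 + (2 * π * (n + 1)) ^ 2) =
      1 / (Real.exp t - 1) - 1 / t + 1 / 2 := by
  have hpi : (π : ℂ) ≠ 0 := by exact_mod_cast Real.pi_ne_zero
  have ht0 : (t : ℂ) ≠ 0 := by exact_mod_cast ht.ne'
  set z : ℂ := Complex.I * t / (2 * π) with hz
  have hz' : z = ((t / (2 * π) : ℝ) : ℂ) * Complex.I := by
    rw [hz]
    push_cast
    ring
  have hzim : 0 < z.im := by
    rw [hz', Complex.im_ofReal_mul, Complex.I_im]
    positivity
  have hmem : z ∈ Complex.integerComplement :=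
    UpperHalfPlane.coe_mem_integerComplement ⟨z, hzim⟩
  have hterm : ∀ n : ℕ, 1 / (z - (n + 1)) + 1 / (z + (n + 1)) =
      -(2 * π * Complex.I) * (2 * ((t / (t ^ 2 + (2 * π * (n + 1)) ^ 2) : ℝ) : ℂ)) := fun n => by
    have hpos : 0 < t ^ 2 + (2 * π * (n + 1)) ^ 2 := by positivity
    have hne : (t : ℂ) ^ 2 + (2 * π * (n + 1)) ^ 2 ≠ 0 := by exact_mod_cast hpos.ne'
    have h := cotTerm_identity hmem n
    have hprod : (z + (n + 1)) * (z - (n + 1)) =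
        -((t : ℂ) ^ 2 + (2 * π * (n + 1)) ^ 2) / (2 * π) ^ 2 := by
      rw [hz]
      field_simp
      ring_nf
      rw [Complex.I_sq]
      ring
    rw [cotTerm, hprod] at h
    rw [h, hz]
    push_cast
    field_simp
  have hexp : 2 * π * Complex.I * z = -(t : ℂ) := by
    rw [hz]
    field_simp
    rw [Complex.I_sq]
  have hcot := cot_series_rep' hmem
  simp_rw [hterm] at hcot
  rw [tsum_mul_left, tsum_mul_left, Complex.cot_pi_eq_exp_ratio, hexp, Complex.exp_neg,
    ← Complex.ofReal_tsum, hz] at hcot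
  have hE : 0 < Real.exp t - 1 := sub_pos.2 (Real.one_lt_exp_iff.2 ht)
  have hE' : Complex.exp t - 1 ≠ 0 := by exact_mod_cast hE.ne'
  have hE0 := Complex.exp_ne_zero t
  rw [← Complex.ofReal_inj]
  push_cast at hcot ⊢
  have hc : -(2 * π * Complex.I) ≠ 0 := by simp [hpi]
  refine mul_left_cancel₀ hc (hcot.symm.trans ?_)
  have h3 : 1 - (Complex.exp t)⁻¹ = (Complex.exp t - 1) / Complex.exp t := by field_simp
  rw [h3]
  field_simp
  ring_nf
  simp only [Complex.I_sq]
  ring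

theorem legendre_relation (t : ℝ) (ht : 0 < t) :
    2 * ∫ x in Ioi (0 : ℝ), Real.sin (x * t) / (Real.exp (2 * π * x) - 1) =
      1 / (Real.exp t - 1) - 1 / t + 1 / 2 := by
  have ha : ∀ n : ℕ, 0 < 2 * π * ((n : ℝ) + 1) := fun n => by positivity
  have hsum : Summable fun n : ℕ => ∫ x in Ioi (0 : ℝ),
      ‖Real.sin (x * t) * Real.exp (-(2 * π * (n + 1) * x))‖ := by
    refine .of_nonneg_of_le (fun n => integral_nonneg fun x => norm_nonneg _)
      (fun n => integral_norm_sin_mul_exp_neg_mul_le (ha n) ht.le) (.mul_left t ?_)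
    have h := (summable_nat_add_iff 1).2 (Real.summable_one_div_nat_pow.2 one_lt_two)
    refine (h.mul_left (1 / (2 * π) ^ 2)).congr fun n => ?_
    push_cast
    rw [mul_pow (2 * π), one_div_mul_one_div]
  have h := hasSum_integral_of_summable_integral_norm
    (fun n : ℕ => integrableOn_sin_mul_exp_neg_mul (ha n) t) hsum
  simp_rw [integral_sin_mul_exp_neg_mul (ha _)] at h
  rw [← two_mul_tsum_div_sq_add_sq ht, h.tsum_eq]
  congr 1
  refine setIntegral_congr_fun measurableSet_Ioi fun x hx => ?_
  have hx : 0 < x := hx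
  have hy : 0 < 2 * π * x := by positivity
  rw [tsum_mul_left, div_eq_mul_one_div, ← tsum_exp_neg_succ_mul hy]
  congr! 5
  ring
end

section
/- For all real numbers u > 0 and s > 0, one has ∫₀^∞ (1/(e^{2πx} − 1)) · (∫₀^∞ e^{-u y²} y^{2s-1} sin(x y²) dy) dx = (1/2) · ∫₀^∞ e^{-u y²} y^{2s-1} (1/(e^{y²} − 1) − 1/y² + 1/2) dy. -/
open MeasureTheory Real Set

/-- The Laplace transform of the sine function. -/
lemma integral_exp_neg_mul_sin_Ioi {b : ℝ} (hb : 0 < b) (t : ℝ) :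
    ∫ x in Ioi (0 : ℝ), exp (-b * x) * sin (x * t) = t / (t ^ 2 + b ^ 2) := by
  have ha : ((-b : ℂ) + t * Complex.I).re < 0 := by simpa using hb
  have h := integral_exp_mul_complex_Ioi ha 0
  have him : ∀ x : ℝ, exp (-b * x) * sin (x * t) =
      RCLike.im (Complex.exp (((-b : ℂ) + t * Complex.I) * x)) := by
    intro x
    simp [Complex.exp_im, mul_comm]
  simp_rw [him]
  rw [integral_im (integrableOn_exp_mul_complex_Ioi ha 0), h]
  simp [Complex.div_im, Complex.normSq_apply]
  ring

lemma integrableOn_mul_exp_neg_mul_Ioi {b : ℝ} (hb : 0 < b) :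
    IntegrableOn (fun x : ℝ => x * exp (-b * x)) (Ioi 0) := by
  simpa using integrableOn_rpow_mul_exp_neg_mul_rpow (p := 1) (s := 1) (by norm_num) one_pos hb

lemma integral_mul_exp_neg_mul_Ioi {b : ℝ} (hb : 0 < b) :
    ∫ x in Ioi (0 : ℝ), x * exp (-b * x) = 1 / b ^ 2 := by
  have h := integral_rpow_mul_exp_neg_mul_Ioi (a := 2) two_pos hb
  norm_num at h
  simpa using h

lemma norm_exp_mul_sin_le {x t : ℝ} (hx : 0 < x) (ht : 0 < t) (b : ℝ) :
    ‖exp (-b * x) * sin (x * t)‖ ≤ t * (x * exp (-b * x)) := by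
  have h := Real.abs_sin_le_abs (x := x * t)
  rw [abs_of_pos (mul_pos hx ht)] at h
  rw [norm_mul, norm_eq_abs, norm_eq_abs, abs_exp]
  nlinarith [exp_pos (-b * x)]

lemma integrableOn_exp_neg_mul_sin_Ioi {b t : ℝ} (hb : 0 < b) (ht : 0 < t) :
    IntegrableOn (fun x : ℝ => exp (-b * x) * sin (x * t)) (Ioi 0) := by
  refine Integrable.mono' ((integrableOn_mul_exp_neg_mul_Ioi hb).const_mul t)
    (by fun_prop) ?_
  filter_upwards [ae_restrict_mem measurableSet_Ioi] with x hx
  exact norm_exp_mul_sin_le hx ht b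

/-- The partial fraction expansion of the hyperbolic cotangent. -/
lemma tsum_div_sq_add_sq {t : ℝ} (ht : 0 < t) :
    ∑' n : ℕ, t / (t ^ 2 + (2 * π * (n + 1)) ^ 2) =
      (1 / 2) * (1 / (exp t - 1) - 1 / t + 1 / 2) := by
  have hpi : (π : ℂ) ≠ 0 := by exact_mod_cast pi_ne_zero
  have htc : (t : ℂ) ≠ 0 := by exact_mod_cast ht.ne'
  set z : ℂ := Complex.I * t / (2 * π) with hz
  have hzim : z.im = t / (2 * π) := by
    rw [hz, show Complex.I * t / (2 * π) = ((t / (2 * π) : ℝ) : ℂ) * Complex.I by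
      push_cast; ring]
    rw [Complex.im_ofReal_mul, Complex.I_im, mul_one]
  have hzim0 : z.im ≠ 0 := by rw [hzim]; positivity
  have hzmem : z ∈ Complex.integerComplement := by
    rw [Complex.mem_integerComplement_iff]
    rintro ⟨n, hn⟩
    rw [← hn] at hzim0
    simp at hzim0
  have hseries := cot_series_rep' hzmem
  have hterm : ∀ n : ℕ, 1 / (z - (n + 1)) + 1 / (z + (n + 1)) =
      (-4 * π * Complex.I) * ((t / (t ^ 2 + (2 * π * (n + 1)) ^ 2) : ℝ) : ℂ) := by
    intro n
    have h1 : z - (n + 1) ≠ 0 := by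
      intro h
      apply hzim0
      simpa using congrArg Complex.im h
    have h2 : z + (n + 1) ≠ 0 := by
      intro h
      apply hzim0
      simpa using congrArg Complex.im h
    have hden : (t : ℂ) ^ 2 + (2 * π * (n + 1)) ^ 2 =
        -(2 * π) ^ 2 * ((z - (n + 1)) * (z + (n + 1))) := by
      rw [hz]
      field_simp
      linear_combination (t : ℂ) ^ 2 * Complex.I_sq
    have hnum : (t : ℂ) = -Complex.I * (2 * π) * z := by
      rw [hz]
      field_simp
      linear_combination Complex.I_sq
    push_cast
    rw [hden]
    nth_rewrite 1 [hnum]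
    field_simp
    linear_combination 4 * z * Complex.I_sq
  simp_rw [hterm] at hseries
  rw [tsum_mul_left, ← Complex.ofReal_tsum, Complex.cot_pi_eq_exp_ratio,
    show 2 * π * Complex.I * z = -(t : ℂ) by
      rw [hz]; field_simp; exact Complex.I_sq, Complex.exp_neg] at hseries
  have he : (Complex.exp t - 1) ≠ 0 := by
    have : exp t - 1 ≠ 0 := by linarith [add_one_lt_exp ht.ne']
    exact_mod_cast this
  have he0 := Complex.exp_ne_zero t
  have he1 : 1 - (Complex.exp t)⁻¹ ≠ 0 := by
    intro h
    apply he
    field_simp at h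
    simpa using h
  have key : (-4 * π * Complex.I) * ((1 / 2) * (1 / (Complex.exp t - 1) - 1 / t + 1 / 2)) =
      π * (((Complex.exp t)⁻¹ + 1) / (Complex.I * (1 - (Complex.exp t)⁻¹))) - 1 / z := by
    have hr : ((Complex.exp t)⁻¹ + 1) / (Complex.I * (1 - (Complex.exp t)⁻¹)) =
        -Complex.I * ((Complex.exp t + 1) / (Complex.exp t - 1)) := by
      rw [show 1 - (Complex.exp t)⁻¹ = (Complex.exp t - 1) / Complex.exp t by field_simp]
      field_simp
      linear_combination (1 + Complex.exp t) * Complex.I_sq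
    have hzi : 1 / z = -Complex.I * (2 * π / t) := by
      rw [hz]
      field_simp
      linear_combination Complex.I_sq
    rw [hr, hzi]
    field_simp
    ring
  rw [← key] at hseries
  have h := mul_left_cancel₀ (by simp [hpi] : (-4 * π * Complex.I) ≠ 0) hseries
  apply Complex.ofReal_injective
  rw [← h]
  push_cast
  rfl

lemma tsum_exp_neg_mul_succ {x : ℝ} (hx : 0 < x) :
    ∑' n : ℕ, exp (-(2 * π * (n + 1)) * x) = 1 / (exp (2 * π * x) - 1) := by
  have hpos : 0 < 2 * π * x := by positivity
  have h : ∀ n : ℕ, exp (-(2 * π * (n + 1)) * x) =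
      exp (-(2 * π * x)) * exp (-(2 * π * x)) ^ n := by
    intro n
    rw [← exp_nat_mul, ← exp_add]
    ring_nf
  have hlt : exp (-(2 * π * x)) < 1 := by simpa using hpos
  have he : exp (2 * π * x) - 1 ≠ 0 := by linarith [add_one_lt_exp hpos.ne']
  simp_rw [h]
  rw [tsum_mul_left, tsum_geometric_of_lt_one (exp_pos _).le hlt, exp_neg]
  have h0 := exp_pos (2 * π * x)
  rw [show 1 - (exp (2 * π * x))⁻¹ = (exp (2 * π * x) - 1) / exp (2 * π * x) by field_simp]
  field_simp

/-- **Legendre's relation**. -/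
theorem integral_sin_div_exp_sub_one {t : ℝ} (ht : 0 < t) :
    ∫ x in Ioi (0 : ℝ), (1 / (exp (2 * π * x) - 1)) * sin (x * t) =
      (1 / 2) * (1 / (exp t - 1) - 1 / t + 1 / 2) := by
  have hb : ∀ n : ℕ, 0 < 2 * π * ((n : ℝ) + 1) := fun n => by positivity
  have hsum : Summable fun n : ℕ => ∫ x in Ioi (0 : ℝ),
      ‖exp (-(2 * π * ((n : ℝ) + 1)) * x) * sin (x * t)‖ := by
    have hS : Summable fun n : ℕ => t * (1 / (2 * π * ((n : ℝ) + 1)) ^ 2) := by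
      have h := ((summable_nat_add_iff 1).2
        (Real.summable_one_div_nat_pow.2 (one_lt_two))).mul_left (t / (2 * π) ^ 2)
      refine h.congr fun n => ?_
      push_cast
      field_simp
    refine hS.of_nonneg_of_le (fun n => integral_nonneg fun x => norm_nonneg _) fun n => ?_
    rw [← integral_mul_exp_neg_mul_Ioi (hb n), ← integral_const_mul]
    refine setIntegral_mono_on (integrableOn_exp_neg_mul_sin_Ioi (hb n) ht).norm
      ((integrableOn_mul_exp_neg_mul_Ioi (hb n)).const_mul t) measurableSet_Ioi fun x hx => ?_
    exact norm_exp_mul_sin_le hx ht _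
  have h := hasSum_integral_of_summable_integral_norm
    (fun n : ℕ => integrableOn_exp_neg_mul_sin_Ioi (hb n) ht) hsum
  rw [← tsum_div_sq_add_sq ht]
  simp_rw [integral_exp_neg_mul_sin_Ioi (hb _)] at h
  rw [h.tsum_eq]
  refine setIntegral_congr_fun measurableSet_Ioi fun x hx => ?_
  rw [tsum_mul_right, tsum_exp_neg_mul_succ hx]

lemma div_exp_sub_one_le {x : ℝ} (hx : 0 < x) :
    1 / (exp (2 * π * x) - 1) * x ≤ exp (-π * x) := by
  have hpos : 0 < π * x := by positivity
  have hsinh := self_le_sinh_iff.2 hpos.le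
  have hE : exp (2 * π * x) = exp (π * x) * exp (π * x) := by rw [← exp_add]; ring_nf
  have hprod : exp (-π * x) * exp (π * x) = 1 := by rw [← exp_add]; simp
  have h1 : 0 < exp (2 * π * x) - 1 := by
    linarith [add_one_lt_exp (show 2 * π * x ≠ 0 by positivity)]
  rw [one_div_mul_eq_div, div_le_iff₀ h1, hE, mul_sub, ← mul_assoc, hprod]
  rw [sinh_eq] at hsinh
  rw [neg_mul]
  nlinarith [pi_gt_three]

lemma integrable_interchange_integrand {u s : ℝ} (hu : 0 < u) (hs : 0 < s) :
    Integrable (Function.uncurry fun x y : ℝ => (1 / (exp (2 * π * x) - 1)) *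
        (exp (-u * y ^ 2) * y ^ (2 * s - 1) * sin (x * y ^ 2)))
      ((volume.restrict (Ioi 0)).prod (volume.restrict (Ioi 0))) := by
  have hx : IntegrableOn (fun x : ℝ => exp (-π * x)) (Ioi 0) :=
    exp_neg_integrableOn_Ioi 0 pi_pos
  have hy : IntegrableOn (fun y : ℝ => y ^ (2 * s + 1) * exp (-u * y ^ 2)) (Ioi 0) :=
    integrableOn_rpow_mul_exp_neg_mul_sq hu (by linarith)
  refine Integrable.mono' (hx.mul_prod hy) ?_ ?_
  · apply Measurable.aestronglyMeasurable
    unfold Function.uncurry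
    fun_prop
  · rw [Measure.prod_restrict]
    filter_upwards [ae_restrict_mem (measurableSet_Ioi.prod measurableSet_Ioi)] with p hp
    obtain ⟨x, y⟩ := p
    obtain ⟨hx0 : 0 < x, hy0 : 0 < y⟩ := hp
    have h1 : 0 < exp (2 * π * x) - 1 := by
      rw [sub_pos, one_lt_exp_iff]
      positivity
    have hsin : |sin (x * y ^ 2)| ≤ x * y ^ 2 :=
      Real.abs_sin_le_abs.trans_eq (abs_of_pos (by positivity))
    have hpow : y ^ (2 * s + 1) = y ^ (2 * s - 1) * y ^ 2 := by
      rw [← rpow_two, ← rpow_add hy0]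
      ring_nf
    simp only [Function.uncurry]
    rw [norm_mul, norm_mul, norm_of_nonneg (one_div_pos.2 h1).le,
      norm_of_nonneg (by positivity : 0 ≤ exp (-u * y ^ 2) * y ^ (2 * s - 1)), norm_eq_abs, hpow]
    calc 1 / (exp (2 * π * x) - 1) * (exp (-u * y ^ 2) * y ^ (2 * s - 1) * |sin (x * y ^ 2)|)
        ≤ 1 / (exp (2 * π * x) - 1) * (exp (-u * y ^ 2) * y ^ (2 * s - 1) * (x * y ^ 2)) := by
          gcongr
      _ = (1 / (exp (2 * π * x) - 1) * x) * (y ^ (2 * s - 1) * y ^ 2 * exp (-u * y ^ 2)) := by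
          ring
      _ ≤ _ := by
          gcongr
          exact div_exp_sub_one_le hx0

theorem interchange_and_legendre (u s : ℝ) (hu : 0 < u) (hs : 0 < s) :
    (∫ x in Ioi (0 : ℝ), (1 / (Real.exp (2 * π * x) - 1)) *
        ∫ y in Ioi (0 : ℝ), Real.exp (-u * y ^ 2) * y ^ (2 * s - 1) * Real.sin (x * y ^ 2)) =
      (1 / 2) * ∫ y in Ioi (0 : ℝ), Real.exp (-u * y ^ 2) * y ^ (2 * s - 1) *
        (1 / (Real.exp (y ^ 2) - 1) - 1 / y ^ 2 + 1 / 2) := by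
  simp_rw [← integral_const_mul]
  rw [integral_integral_swap (integrable_interchange_integrand hu hs)]
  refine setIntegral_congr_fun measurableSet_Ioi fun y (hy : 0 < y) => ?_
  have h := integral_sin_div_exp_sub_one (show 0 < y ^ 2 by positivity)
  rw [mul_left_comm, ← h, ← integral_const_mul]
  congr 1 with x
  ring
end

section
/- For all real numbers u > 0 and x, one has 2 · ∫₀^∞ e^{-u y²} sin(x y²) / y dy = arctan(x/u). -/
open MeasureTheory Real Set

/-- The Laplace transform of `t ↦ cos (x * t)`. -/
lemma integral_exp_neg_mul_cos {u : ℝ} (hu : 0 < u) (x : ℝ) :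
    ∫ t in Ioi (0 : ℝ), exp (-u * t) * cos (x * t) = u / (u ^ 2 + x ^ 2) := by
  have ha : (-u + x * Complex.I : ℂ).re < 0 := by simpa using hu
  have hre : ∀ t : ℝ, exp (-u * t) * cos (x * t) =
      RCLike.re (Complex.exp ((-u + x * Complex.I) * t)) := fun t => by
    simp [Complex.exp_re]
  simp_rw [hre]
  rw [integral_re (integrableOn_exp_mul_complex_Ioi ha 0), integral_exp_mul_complex_Ioi ha 0]
  simp [Complex.div_re, Complex.normSq_apply, sq]

lemma norm_exp_mul_sin_div_le (u x t : ℝ) :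
    ‖exp (-u * t) * sin (x * t) / t‖ ≤ |x| * exp (-u * t) := by
  rcases eq_or_ne t 0 with rfl | ht
  · simp
  rw [norm_div, norm_mul, norm_eq_abs, norm_eq_abs, norm_eq_abs, abs_exp,
    div_le_iff₀ (abs_pos.2 ht)]
  calc exp (-u * t) * |sin (x * t)| ≤ exp (-u * t) * |x * t| := by
        exact mul_le_mul_of_nonneg_left abs_sin_le_abs (exp_pos _).le
    _ = |x| * exp (-u * t) * |t| := by rw [abs_mul]; ring

lemma integrableOn_exp_mul_sin_div {u : ℝ} (hu : 0 < u) (x : ℝ) :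
    IntegrableOn (fun t => exp (-u * t) * sin (x * t) / t) (Ioi 0) := by
  refine Integrable.mono' ((integrableOn_exp_mul_Ioi (neg_lt_zero.2 hu) 0).const_mul |x|)
    (Measurable.aestronglyMeasurable (by fun_prop)) ?_
  exact .of_forall fun t => norm_exp_mul_sin_div_le u x t

lemma hasDerivAt_integral_exp_mul_sin_div {u : ℝ} (hu : 0 < u) (x : ℝ) :
    HasDerivAt (fun x => ∫ t in Ioi (0 : ℝ), exp (-u * t) * sin (x * t) / t)
      (u / (u ^ 2 + x ^ 2)) x := by
  rw [← integral_exp_neg_mul_cos hu x]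
  refine (hasDerivAt_integral_of_dominated_loc_of_deriv_le
    (F := fun x t => exp (-u * t) * sin (x * t) / t)
    (F' := fun x t => exp (-u * t) * cos (x * t)) (bound := fun t => exp (-u * t))
    Filter.univ_mem (.of_forall fun y => (integrableOn_exp_mul_sin_div hu y).1)
    (integrableOn_exp_mul_sin_div hu x) (Measurable.aestronglyMeasurable (by fun_prop))
    (.of_forall fun t y _ => ?_) (integrableOn_exp_mul_Ioi (neg_lt_zero.2 hu) 0) ?_).2
  · rw [norm_mul, norm_eq_abs, norm_eq_abs, abs_exp]
    exact mul_le_of_le_one_right (exp_pos _).le (abs_cos_le_one _)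
  · filter_upwards [ae_restrict_mem measurableSet_Ioi] with t ht y _
    have ht0 : t ≠ 0 := (mem_Ioi.1 ht).ne'
    refine ((((hasDerivAt_id' y).mul_const t).sin.const_mul (exp (-u * t))).div_const t
      ).congr_deriv ?_
    field_simp

lemma integral_exp_mul_sin_div {u : ℝ} (hu : 0 < u) (x : ℝ) :
    ∫ t in Ioi (0 : ℝ), exp (-u * t) * sin (x * t) / t = arctan (x / u) := by
  have harctan : ∀ y : ℝ, HasDerivAt (fun y => arctan (y / u)) (u / (u ^ 2 + y ^ 2)) y := by
    intro y
    refine ((hasDerivAt_id' y).div_const u).arctan.congr_deriv ?_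
    field_simp
  have hderiv := fun y => (hasDerivAt_integral_exp_mul_sin_div hu y).sub (harctan y)
  have hconst := is_const_of_deriv_eq_zero (fun y => (hderiv y).differentiableAt)
    (fun y => by rw [(hderiv y).deriv, sub_self]) x 0
  simpa [sub_eq_zero] using hconst

theorem gaussian_arctan_integral (u x : ℝ) (hu : 0 < u) :
    2 * ∫ y in Ioi (0 : ℝ), Real.exp (-u * y ^ 2) * Real.sin (x * y ^ 2) / y =
      Real.arctan (x / u) := by
  rw [← integral_exp_mul_sin_div hu x, ← integral_const_mul,
    ← integral_comp_rpow_Ioi_of_pos (g := fun t => exp (-u * t) * sin (x * t) / t) two_pos]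
  refine setIntegral_congr_fun measurableSet_Ioi fun y hy => ?_
  have hy0 : y ≠ 0 := (mem_Ioi.1 hy).ne'
  norm_num
  field_simp
end
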